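/- The function Ψ(x,t) := x(t+1)/(1−x) solves the PDE ∂Ψ/∂t(x,t) = x·(∂Ψ/∂x)(x,t)/Ψ(x,t) − 1 for all 0<x<1 and t≥0. Its x-derivative equals ψ(x,t) = (t+1)/(1−x)². -/

import Mathlib

theorem hasDerivAt_mul_div_one_sub (c : ℝ) {x : ℝ} (hx : 1 - x ≠ 0) :
    HasDerivAt (fun y => y * c / (1 - y)) (c / (1 - x) ^ 2) x := by
  refine (((hasDerivAt_id' x).mul_const c).fun_div
    ((hasDerivAt_id' x).const_sub 1) hx).congr_deriv ?_
  ring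

theorem hasDerivAt_mul_add_one_div (a b t : ℝ) :
    HasDerivAt (fun s => a * (s + 1) / b) (a / b) t := by
  simpa using (((hasDerivAt_id' t).add_const 1).const_mul a).div_const b


/-- `Ψ(x,t) = x(t+1)/(1−x)` solves `∂Ψ/∂t = x·(∂Ψ/∂x)/Ψ − 1` for all
`0 < x < 1` and `t ≥ 0`; its `x`-derivative equals `(t+1)/(1−x)²`. -/
theorem stmt_12 :
    ∀ t ≥ (0:ℝ), ∀ x ∈ Set.Ioo (0:ℝ) 1,
      deriv (fun s => x * (s + 1) / (1 - x)) t
          = x * deriv (fun y => y * (t + 1) / (1 - y)) x / (x * (t + 1) / (1 - x)) - 1 ∧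
      deriv (fun y => y * (t + 1) / (1 - y)) x = (t + 1) / (1 - x) ^ 2 := by
  rintro t ht x ⟨hx0, hx1⟩
  have hx : 1 - x ≠ 0 := (sub_pos.mpr hx1).ne'
  have ht' : t + 1 ≠ 0 := by linarith
  have hx0' : x ≠ 0 := hx0.ne'
  rw [(hasDerivAt_mul_add_one_div x (1 - x) t).deriv,
    (hasDerivAt_mul_div_one_sub (t + 1) hx).deriv]
  refine ⟨?_, rfl⟩
  field_simp
  ring
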